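/- Let I be the two-sided ideal of the even Clifford algebra A of the quadratic form diag(1,1,0) on ℂ³ generated by {y, z}. Then the quotient A/I is isomorphic as a ℂ-algebra to ℂ × ℂ. -/

import Mathlib

open CliffordAlgebra

noncomputable section

/-- The quadratic form `v ↦ v₀² + v₁²` on `ℂ³`, with Gram matrix `diag(1,1,0)` —
the quadratic form of a corank-1 degenerate conic. -/
def Q : QuadraticForm ℂ (Fin 3 → ℂ) := QuadraticMap.weightedSumSquares ℂ ![1, 1, 0]

/-- The standard basis vectors `e₁, e₂, e₃` of `ℂ³` (indexed by `0, 1, 2`). -/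
def e (j : Fin 3) : Fin 3 → ℂ := Pi.single j 1

/-- `x = i·ι(e₁)·ι(e₂)` in the Clifford algebra of `Q`. -/
def x : CliffordAlgebra Q := Complex.I • (ι Q (e 0) * ι Q (e 1))

/-- `y = i·ι(e₂)·ι(e₃)` in the Clifford algebra of `Q`. -/
def y : CliffordAlgebra Q := Complex.I • (ι Q (e 1) * ι Q (e 2))

/-- `z = ι(e₁)·ι(e₃)` in the Clifford algebra of `Q`. -/
def z : CliffordAlgebra Q := ι Q (e 0) * ι Q (e 2)

lemma x_mem : x ∈ even Q := Subalgebra.smul_mem _ (ι_mul_ι_mem_evenOdd_zero Q _ _) _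

lemma y_mem : y ∈ even Q := Subalgebra.smul_mem _ (ι_mul_ι_mem_evenOdd_zero Q _ _) _

lemma z_mem : z ∈ even Q := ι_mul_ι_mem_evenOdd_zero Q _ _

/-- `x` as an element of the even Clifford algebra `A = CliffordAlgebra.even Q`. -/
def xA : even Q := ⟨x, x_mem⟩

/-- `y` as an element of the even Clifford algebra `A = CliffordAlgebra.even Q`. -/
def yA : even Q := ⟨y, y_mem⟩

/-- `z` as an element of the even Clifford algebra `A = CliffordAlgebra.even Q`. -/
def zA : even Q := ⟨z, z_mem⟩

lemma Q_apply (v : Fin 3 → ℂ) : Q v = v 0 * v 0 + v 1 * v 1 := by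
  simp [Q, QuadraticMap.weightedSumSquares_apply, Fin.sum_univ_three]

lemma eq_sum_e (v : Fin 3 → ℂ) : v = v 0 • e 0 + v 1 • e 1 + v 2 • e 2 := by
  ext j
  fin_cases j <;> simp [e]

lemma ι_e_mul_ι_e_of_ne {j k : Fin 3} (h : j ≠ k) :
    ι Q (e j) * ι Q (e k) = -(ι Q (e k) * ι Q (e j)) := by
  rw [eq_neg_iff_add_eq_zero, ι_mul_ι_add_swap, QuadraticMap.polar]
  fin_cases j <;> fin_cases k <;> simp_all [Q_apply, e]

lemma ι_e_mul_self (j : Fin 3) :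
    ι Q (e j) * ι Q (e j) = algebraMap ℂ _ (![1, 1, 0] j) := by
  rw [ι_sq_scalar]
  fin_cases j <;> simp [Q_apply, e]

/-- The product of two vectors in terms of the basis `1, x, y, z` of the even subalgebra. -/
lemma ι_mul_ι_eq (v w : Fin 3 → ℂ) :
    ι Q v * ι Q w = algebraMap ℂ _ (v 0 * w 0 + v 1 * w 1)
      + (-Complex.I * (v 0 * w 1 - v 1 * w 0)) • x
      + (-Complex.I * (v 1 * w 2 - v 2 * w 1)) • y
      + (v 0 * w 2 - v 2 * w 0) • z := by
  have h00 := ι_e_mul_self 0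
  have h11 := ι_e_mul_self 1
  have h22 := ι_e_mul_self 2
  have h10 := ι_e_mul_ι_e_of_ne (show (1 : Fin 3) ≠ 0 by decide)
  have h20 := ι_e_mul_ι_e_of_ne (show (2 : Fin 3) ≠ 0 by decide)
  have h21 := ι_e_mul_ι_e_of_ne (show (2 : Fin 3) ≠ 1 by decide)
  have hI (c : ℂ) : -Complex.I * c * Complex.I = c := by
    linear_combination -c * Complex.I_mul_I
  conv_lhs => rw [eq_sum_e v, eq_sum_e w]
  simp only [map_add, map_smul, add_mul, mul_add, smul_mul_assoc, mul_smul_comm, h00, h11, h22,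
    h10, h20, h21, x, y, z, smul_smul, hI, Algebra.algebraMap_eq_smul_one]
  simp
  module

lemma xA_mul_xA : xA * xA = 1 := by
  have h := ι_e_mul_ι_e_of_ne (show (1 : Fin 3) ≠ 0 by decide)
  apply Subtype.ext
  change x * x = 1
  calc x * x = (-1 : ℂ) • (ι Q (e 0) * (ι Q (e 1) * ι Q (e 0)) * ι Q (e 1)) := by
        simp [x, smul_smul, mul_assoc]
    _ = ι Q (e 0) * ι Q (e 0) * (ι Q (e 1) * ι Q (e 1)) := by
        simp only [h, mul_neg, neg_mul, neg_smul, one_smul, neg_neg, mul_assoc]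
    _ = 1 := by rw [ι_e_mul_self, ι_e_mul_self]; simp

/-- The bilinear map inducing the projection of the even Clifford algebra onto `ℂ × ℂ`. -/
def evenHomProd : EvenHom Q (ℂ × ℂ) where
  bilin := LinearMap.mk₂ ℂ
    (fun v w => ((v 0 + Complex.I * v 1) * (w 0 - Complex.I * w 1),
      (v 0 - Complex.I * v 1) * (w 0 + Complex.I * w 1)))
    (fun _ _ _ => by ext <;> simp <;> ring)
    (fun _ _ _ => by ext <;> simp <;> ring)
    (fun _ _ _ => by ext <;> simp <;> ring)
    (fun _ _ _ => by ext <;> simp <;> ring)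
  contract v := by
    ext <;> simp [Q_apply] <;> linear_combination -(v 1 * v 1) * Complex.I_mul_I
  contract_mid u v w := by
    ext <;> simp [Q_apply]
    · linear_combination -(v 1 * v 1) * (u 0 + Complex.I * u 1) * (w 0 - Complex.I * w 1)
        * Complex.I_mul_I
    · linear_combination -(v 1 * v 1) * (u 0 - Complex.I * u 1) * (w 0 + Complex.I * w 1)
        * Complex.I_mul_I

/-- The projection of the even Clifford algebra onto `ℂ × ℂ`. -/
def evenToProd : even Q →ₐ[ℂ] ℂ × ℂ := even.lift Q evenHomProd

lemma evenToProd_ι (v w : Fin 3 → ℂ) :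
    evenToProd ((even.ι Q).bilin v w) = evenHomProd.bilin v w :=
  even.lift_ι Q evenHomProd v w

lemma evenToProd_xA : evenToProd xA = (1, -1) := by
  have h : xA = Complex.I • (even.ι Q).bilin (e 0) (e 1) := rfl
  rw [h, map_smul, evenToProd_ι]
  simp [evenHomProd, e]

lemma evenToProd_yA : evenToProd yA = 0 := by
  have h : yA = Complex.I • (even.ι Q).bilin (e 1) (e 2) := rfl
  rw [h, map_smul, evenToProd_ι]
  simp [evenHomProd, e]

lemma evenToProd_zA : evenToProd zA = 0 := by
  have h : zA = (even.ι Q).bilin (e 0) (e 2) := rfl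
  rw [h, evenToProd_ι]
  simp [evenHomProd, e]

lemma evenToProd_smul_one_add_smul_xA (a b : ℂ) :
    evenToProd (a • 1 + b • xA) = (a + b, a - b) := by
  rw [map_add, map_smul, map_smul, map_one, evenToProd_xA]
  ext <;> simp [sub_eq_add_neg]

lemma smul_mem_twoSidedIdeal {R A : Type*} [CommRing R] [Ring A] [Algebra R A]
    (I : TwoSidedIdeal A) (c : R) {a : A} (ha : a ∈ I) : c • a ∈ I := by
  rw [Algebra.smul_def]
  exact I.mul_mem_left _ _ ha

/-- Modulo the ideal generated by `y` and `z`, the even Clifford algebra is spanned by `1, x`. -/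
lemma exists_sub_mem_span (a : even Q) :
    ∃ c d : ℂ, a - (c • 1 + d • xA) ∈ TwoSidedIdeal.span {yA, zA} := by
  set I := TwoSidedIdeal.span {yA, zA}
  have hy : yA ∈ I := TwoSidedIdeal.subset_span (by simp)
  have hz : zA ∈ I := TwoSidedIdeal.subset_span (by simp)
  obtain ⟨a, ha⟩ := a
  induction a, ha using even_induction Q with
  | algebraMap r =>
    refine ⟨r, 0, ?_⟩
    convert I.zero_mem
    apply Subtype.ext
    simp [Algebra.algebraMap_eq_smul_one]
  | add a b ha hb iha ihb =>
    obtain ⟨c, d, h⟩ := iha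
    obtain ⟨c', d', h'⟩ := ihb
    refine ⟨c + c', d + d', ?_⟩
    have hab : (⟨a + b, (even Q).add_mem ha hb⟩ : even Q) = ⟨a, ha⟩ + ⟨b, hb⟩ := rfl
    convert I.add_mem h h' using 1
    refine Eq.trans (congrArg (· - _) hab) ?_
    module
  | ι_mul_ι_mul v w b hb ih =>
    obtain ⟨c, d, h⟩ := ih
    obtain ⟨p, q, r, s, hp⟩ : ∃ p q r s : ℂ,
        (even.ι Q).bilin v w = p • 1 + q • xA + r • yA + s • zA :=
      ⟨_, _, _, _, Subtype.ext ((ι_mul_ι_eq v w).trans (by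
        rw [Algebra.algebraMap_eq_smul_one]; rfl))⟩
    refine ⟨p * c + q * d, p * d + q * c, ?_⟩
    have hm := I.add_mem (I.mul_mem_left ((even.ι Q).bilin v w) _ h)
      (I.mul_mem_right _ (c • 1 + d • xA)
        (I.add_mem (smul_mem_twoSidedIdeal I r hy) (smul_mem_twoSidedIdeal I s hz)))
    convert hm using 1
    change (even.ι Q).bilin v w * ⟨b, hb⟩ - _ = _
    rw [hp]
    simp only [mul_sub, mul_add, add_mul, smul_mul_assoc, mul_smul_comm, one_mul, mul_one,
      xA_mul_xA]
    module

/-- Let `I` be the two-sided ideal of the even Clifford algebra `A` of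
`diag(1,1,0)` on `ℂ³` generated by `{y, z}`.  Then `A/I ≅ ℂ × ℂ` as `ℂ`-algebras;
equivalently (by the first isomorphism theorem), there is a surjective `ℂ`-algebra
homomorphism `A → ℂ × ℂ` whose kernel is exactly `I`. -/
theorem quotient_by_radical :
    ∃ φ : even Q →ₐ[ℂ] ℂ × ℂ, Function.Surjective φ ∧
      RingHom.ker (φ : even Q →+* ℂ × ℂ) =
        TwoSidedIdeal.asIdeal (TwoSidedIdeal.span {yA, zA}) := by
  refine ⟨evenToProd, fun u => ⟨((u.1 + u.2) / 2) • 1 + ((u.1 - u.2) / 2) • xA, ?_⟩, ?_⟩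
  · rw [evenToProd_smul_one_add_smul_xA]
    ext <;> ring
  · have hle : TwoSidedIdeal.span {yA, zA} ≤ TwoSidedIdeal.ker evenToProd := by
      rw [TwoSidedIdeal.span_le]
      rintro _ (rfl | rfl)
      · exact (TwoSidedIdeal.mem_ker _).2 evenToProd_yA
      · exact (TwoSidedIdeal.mem_ker _).2 evenToProd_zA
    ext a
    rw [TwoSidedIdeal.mem_asIdeal, RingHom.mem_ker]
    refine ⟨fun ha => ?_, fun ha => (TwoSidedIdeal.mem_ker _).1 (hle ha)⟩
    obtain ⟨c, d, h⟩ := exists_sub_mem_span a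
    have h0 := (TwoSidedIdeal.mem_ker _).1 (hle h)
    have ha' : evenToProd a = 0 := ha
    rw [map_sub, ha', evenToProd_smul_one_add_smul_xA, zero_sub, neg_eq_zero, Prod.mk_eq_zero]
      at h0
    have hc : c = 0 := by linear_combination (h0.1 + h0.2) / 2
    have hd : d = 0 := by linear_combination (h0.1 - h0.2) / 2
    simpa [hc, hd] using h
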